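/- Quantitative homogenization with non-separated scales toward a variable-coefficient effective equation (Section 7.1): Let α ∈ (0, 1/2). There exists a constant C, depending only on α, such that the following holds for every ε ∈ (0,1). Define a_ε(x) = ( 1 + 2α·sin(2πx/ε)·sin(2π(1+ε)x/ε) )⁻¹ and ā(x) = ( 1 + α·cos(2πx) )⁻¹ for x ∈ [0,1]. Let f : [0,1] → ℝ be continuous, and let u_ε, u₀ : [0,1] → ℝ be continuous functions with u_ε(0) = u_ε(1) = u₀(0) = u₀(1) = 0, differentiable on (0,1), such that x ↦ a_ε(x)·u_ε′(x) and x ↦ ā(x)·u₀′(x) are differentiable on (0,1) with (a_ε·u_ε′)′(x) = −f(x) and (ā·u₀′)′(x) = −f(x) for all x ∈ (0,1). Then ( ∫₀¹ |u_ε(x) − u₀(x)|² dx )^{1/2} ≤ C·ε·sup over [0,1] of |f|. -/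

import Mathlib

open Real MeasureTheory

/-- Mean value inequality with derivative information only in the open interval. -/
theorem abs_sub_le_of_hasDerivAt_Ioo {w w' : ℝ → ℝ} {a b K : ℝ} (hab : a ≤ b)
    (hc : ContinuousOn w (Set.Icc a b)) (hd : ∀ x ∈ Set.Ioo a b, HasDerivAt w (w' x) x)
    (hK : ∀ x ∈ Set.Ioo a b, |w' x| ≤ K) : |w b - w a| ≤ K * (b - a) := by
  rcases hab.eq_or_lt with rfl | hlt
  · simp
  · obtain ⟨ξ, hξ, h⟩ := exists_hasDerivAt_eq_slope w w' hlt hc hd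
    have hpos : 0 < b - a := sub_pos.2 hlt
    have h2 : w b - w a = w' ξ * (b - a) := by
      rw [h]; field_simp
    rw [h2, abs_mul, abs_of_pos hpos]
    exact mul_le_mul_of_nonneg_right (hK ξ hξ) hpos.le

/-- Two functions with the same derivative on an open interval differ by a constant. -/
theorem exists_eq_add_const_of_hasDerivAt_Ioo {p P q : ℝ → ℝ} {a b : ℝ}
    (hp : ∀ x ∈ Set.Ioo a b, HasDerivAt p (q x) x)
    (hP : ∀ x ∈ Set.Ioo a b, HasDerivAt P (q x) x) :
    ∃ c, ∀ x ∈ Set.Ioo a b, p x = P x + c := by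
  rcases (Set.Ioo a b).eq_empty_or_nonempty with he | ⟨y, hy⟩
  · exact ⟨0, by simp [he]⟩
  refine ⟨p y - P y, fun x hx => ?_⟩
  have hd : ∀ x ∈ Set.Ioo a b, HasDerivAt (fun t => p t - P t) 0 x := fun x hx =>
    ((hp x hx).sub (hP x hx)).congr_deriv (sub_self _)
  have : p x - P x = p y - P y := isOpen_Ioo.is_const_of_deriv_eq_zero isPreconnected_Ioo
    (fun x hx => (hd x hx).differentiableAt.differentiableWithinAt)
    (fun x hx => (hd x hx).deriv) hx hy
  linarith

/-- Uniform corrector estimate: if `u' = (1 + α cos (2πx) - α cos (ωx)) (P + c)` and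
`v' = (1 + α cos (2πx)) (P + d)` with the same zero boundary values, then `u - v = O(1 / ω)`. -/
theorem abs_sub_le_of_oscillating_coefficient {α ω M c d : ℝ} {P q u v : ℝ → ℝ}
    (hα : α ∈ Set.Ioo (0 : ℝ) (1 / 2)) (hω : 1 ≤ ω)
    (hPd : ∀ x, HasDerivAt P (q x) x) (hq : ∀ x ∈ Set.Icc (0 : ℝ) 1, |q x| ≤ M)
    (hu : ContinuousOn u (Set.Icc 0 1)) (hu0 : u 0 = 0) (hu1 : u 1 = 0)
    (hv : ContinuousOn v (Set.Icc 0 1)) (hv0 : v 0 = 0) (hv1 : v 1 = 0)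
    (hud : ∀ x ∈ Set.Ioo (0 : ℝ) 1,
      HasDerivAt u ((1 + α * cos (2 * π * x) - α * cos (ω * x)) * (P x + c)) x)
    (hvd : ∀ x ∈ Set.Ioo (0 : ℝ) 1, HasDerivAt v ((1 + α * cos (2 * π * x)) * (P x + d)) x)
    {x : ℝ} (hx : x ∈ Set.Icc (0 : ℝ) 1) : |u x - v x| ≤ 5 * M / ω := by
  obtain ⟨hα0, hα1⟩ := hα
  have hω0 : 0 < ω := by linarith
  have hM : 0 ≤ M := (abs_nonneg _).trans (hq 0 (by simp))
  have hPc : Continuous P := continuous_iff_continuousAt.2 fun x => (hPd x).continuousAt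
  have hflux : ∀ x ∈ Set.Icc (0 : ℝ) 1, |P x + d| ≤ M := by
    obtain ⟨ξ, hξ, h⟩ := exists_hasDerivAt_eq_zero one_pos hv (hv0.trans hv1.symm) hvd
    have hpos : 1 + α * cos (2 * π * ξ) ≠ 0 := by
      nlinarith [neg_one_le_cos (2 * π * ξ)]
    have hd : d = -P ξ := by
      have := (mul_eq_zero.1 h).resolve_left hpos
      linarith
    intro x hx
    have := (convex_Icc (0 : ℝ) 1).norm_image_sub_le_of_norm_hasDerivWithin_le
      (fun x _ => (hPd x).hasDerivWithinAt) hq (Set.Ioo_subset_Icc_self hξ) hx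
    rw [hd, ← sub_eq_add_neg]
    refine this.trans (mul_le_of_le_one_right hM ?_)
    rw [Real.norm_eq_abs, abs_le]
    constructor <;> linarith [hx.1, hx.2, hξ.1, hξ.2]
  set κ : ℝ := α / ω with hκ
  have hκ0 : 0 < κ := div_pos hα0 hω0
  have hκ1 : κ ≤ 1 / 2 := (div_le_self hα0.le hω).trans hα1.le
  have hsin : ∀ t : ℝ, |κ * sin t| ≤ κ := fun t => by
    rw [abs_mul, abs_of_pos hκ0]
    exact mul_le_of_le_one_right hκ0.le (abs_sin_le_one t)
  set B : ℝ → ℝ := fun x => x + α * (sin (2 * π * x) / (2 * π)) - κ * sin (ω * x) with hB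
  have hlin : ∀ k x : ℝ, HasDerivAt (fun t => sin (k * t)) (cos (k * x) * k) x := fun k x => by
    simpa using ((hasDerivAt_id x).const_mul k).sin
  have hBd : ∀ x, HasDerivAt B (1 + α * cos (2 * π * x) - α * cos (ω * x)) x := fun x => by
    have h := ((hasDerivAt_id x).add (((hlin (2 * π) x).div_const (2 * π)).const_mul α)).sub
      ((hlin ω x).const_mul κ)
    refine h.congr_deriv ?_
    rw [hκ]
    field_simp
  have hBc : Continuous B := continuous_iff_continuousAt.2 fun x => (hBd x).continuousAt
  set w : ℝ → ℝ := fun x => u x - v x + κ * sin (ω * x) * (P x + d) - (c - d) * B x with hw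
  have hwc : ContinuousOn w (Set.Icc 0 1) := by
    have : Continuous fun x => κ * sin (ω * x) * (P x + d) := by fun_prop
    exact ((hu.sub hv).add this.continuousOn).sub (continuous_const.mul hBc).continuousOn
  have hwd : ∀ x ∈ Set.Ioo (0 : ℝ) 1, HasDerivAt w (κ * sin (ω * x) * q x) x := fun x hx => by
    have h := (((hud x hx).sub (hvd x hx)).add
      (((hlin ω x).const_mul κ).mul ((hPd x).add_const d))).sub ((hBd x).const_mul (c - d))
    refine h.congr_deriv ?_
    rw [hκ]
    field_simp
    ring
  have hw0 : w 0 = 0 := by simp [hw, hB, hu0, hv0]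
  have hwb : ∀ x ∈ Set.Icc (0 : ℝ) 1, |w x| ≤ κ * M := fun x hx => by
    have h := abs_sub_le_of_hasDerivAt_Ioo (K := κ * M) hx.1
      (hwc.mono (Set.Icc_subset_Icc_right hx.2))
      (fun y hy => hwd y ⟨hy.1, hy.2.trans_le hx.2⟩) (fun y hy => by
        rw [abs_mul]
        exact mul_le_mul (hsin _) (hq y ⟨hy.1.le, hy.2.le.trans hx.2⟩) (abs_nonneg _) hκ0.le)
    rw [hw0, sub_zero, sub_zero] at h
    exact h.trans (mul_le_of_le_one_right (by positivity) hx.2)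
  have hcorr : ∀ x ∈ Set.Icc (0 : ℝ) 1, |κ * sin (ω * x) * (P x + d)| ≤ κ * M := fun x hx => by
    rw [abs_mul]
    exact mul_le_mul (hsin _) (hflux x hx) (abs_nonneg _) hκ0.le
  have hcd : |c - d| ≤ 4 * (κ * M) := by
    have h1 : (1 : ℝ) ∈ Set.Icc (0 : ℝ) 1 := by simp
    have hB1 : 1 / 2 ≤ B 1 := by
      have := (abs_le.1 (hsin (ω * 1))).2
      simp only [hB, mul_one, sin_two_pi, zero_div, mul_zero, add_zero] at this ⊢
      linarith
    have heq : (c - d) * B 1 = κ * sin (ω * 1) * (P 1 + d) - w 1 := by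
      simp only [hw, hu1, hv1]; ring
    have h2 : |c - d| * B 1 ≤ κ * M + κ * M := by
      rw [← abs_of_pos (show 0 < B 1 by linarith), ← abs_mul, heq]
      exact (abs_sub _ _).trans (add_le_add (hcorr 1 h1) (hwb 1 h1))
    nlinarith [abs_nonneg (c - d)]
  have hBx : |B x| ≤ 2 := by
    have hs := abs_le.1 (hsin (ω * x))
    have h2 : |α * (sin (2 * π * x) / (2 * π))| ≤ 1 / 2 := by
      rw [abs_mul, abs_div, abs_of_pos hα0, abs_of_pos two_pi_pos]
      have : |sin (2 * π * x)| / (2 * π) ≤ 1 :=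
        div_le_one_of_le₀ ((abs_sin_le_one _).trans (by linarith [pi_gt_three])) two_pi_pos.le
      nlinarith
    have h2 := abs_le.1 h2
    simp only [hB]
    rw [abs_le]
    constructor <;> linarith [hx.1, hx.2]
  have hsplit : u x - v x = w x - κ * sin (ω * x) * (P x + d) + (c - d) * B x := by
    simp only [hw]; ring
  have hprod : |(c - d) * B x| ≤ 4 * (κ * M) * 2 := by
    rw [abs_mul]
    exact mul_le_mul hcd hBx (abs_nonneg _) (by positivity)
  calc |u x - v x| ≤ κ * M + κ * M + 4 * (κ * M) * 2 := by
        rw [hsplit]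
        exact (abs_add_le _ _).trans (add_le_add
          ((abs_sub _ _).trans (add_le_add (hwb x hx) (hcorr x hx))) hprod)
    _ = α * (10 * M / ω) := by rw [hκ]; ring
    _ ≤ 1 / 2 * (10 * M / ω) := mul_le_mul_of_nonneg_right hα1.le (by positivity)
    _ = 5 * M / ω := by ring

/-- Product-to-sum form of the inverse two-scale coefficient. -/
theorem two_scale_coefficient_eq {α ε : ℝ} (hε : ε ≠ 0) (x : ℝ) :
    1 + 2 * α * sin (2 * π * x / ε) * sin (2 * π * (1 + ε) * x / ε)
      = 1 + α * cos (2 * π * x) - α * cos (2 * π * (2 + ε) / ε * x) := by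
  have h1 : 2 * π * (1 + ε) * x / ε = 2 * π * x / ε + 2 * π * x := by field_simp
  have h2 : 2 * π * (2 + ε) / ε * x = 2 * π * x / ε + (2 * π * x / ε + 2 * π * x) := by
    field_simp; ring
  have h3 : cos (2 * π * x) = cos ((2 * π * x / ε + 2 * π * x) - 2 * π * x / ε) := by
    congr 1; ring
  rw [h1, h2, h3, cos_add, cos_sub]
  ring

/-- Section 7.1: quantitative homogenization with two non-separated periodic scales
`ε` and `ε/(1+ε)` toward a variable-coefficient effective equation, with rate `O(ε)`. -/
theorem statement19 (α : ℝ) (hα : α ∈ Set.Ioo (0 : ℝ) (1 / 2)) :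
    ∃ C : ℝ, 0 < C ∧
      ∀ ε : ℝ, ε ∈ Set.Ioo (0 : ℝ) 1 →
      ∀ f uε u₀ uε' u₀' : ℝ → ℝ,
        ContinuousOn f (Set.Icc (0 : ℝ) 1) →
        ContinuousOn uε (Set.Icc (0 : ℝ) 1) → uε 0 = 0 → uε 1 = 0 →
        ContinuousOn u₀ (Set.Icc (0 : ℝ) 1) → u₀ 0 = 0 → u₀ 1 = 0 →
        (∀ x ∈ Set.Ioo (0 : ℝ) 1, HasDerivAt uε (uε' x) x) →
        (∀ x ∈ Set.Ioo (0 : ℝ) 1, HasDerivAt u₀ (u₀' x) x) →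
        (∀ x ∈ Set.Ioo (0 : ℝ) 1,
          HasDerivAt
            (fun t => (1 + 2 * α * Real.sin (2 * Real.pi * t / ε)
                * Real.sin (2 * Real.pi * (1 + ε) * t / ε))⁻¹ * uε' t)
            (-f x) x) →
        (∀ x ∈ Set.Ioo (0 : ℝ) 1,
          HasDerivAt
            (fun t => (1 + α * Real.cos (2 * Real.pi * t))⁻¹ * u₀' t)
            (-f x) x) →
        Real.sqrt (∫ x in Set.Icc (0 : ℝ) 1, (uε x - u₀ x) ^ 2)
          ≤ C * ε * sSup ((fun x => |f x|) '' Set.Icc (0 : ℝ) 1) := by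
  obtain ⟨hα0, hα1⟩ := id hα
  refine ⟨5, by norm_num, ?_⟩
  rintro ε ⟨hε0, hε1⟩ f u v u' v' hf hu hu0 hu1 hv hv0 hv1 hud hvd hau hav
  set M := sSup ((fun x => |f x|) '' Set.Icc (0 : ℝ) 1)
  have hfM : ∀ x ∈ Set.Icc (0 : ℝ) 1, |f x| ≤ M := fun x hx =>
    le_csSup (isCompact_Icc.bddAbove_image hf.abs) (Set.mem_image_of_mem _ hx)
  have hM0 : 0 ≤ M := (abs_nonneg _).trans (hfM 0 (by simp))
  set g : ℝ → ℝ := Set.IccExtend (zero_le_one' ℝ) ((Set.Icc (0 : ℝ) 1).domRestrict f) with hg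
  have hgc : Continuous g := hf.domRestrict.Icc_extend'
  have hgf : ∀ x ∈ Set.Icc (0 : ℝ) 1, g x = f x := fun x hx => by
    rw [hg, Set.IccExtend_of_mem _ _ hx, Set.domRestrict_apply]
  set P : ℝ → ℝ := fun x => -∫ t in (0 : ℝ)..x, g t with hP
  have hPd : ∀ x, HasDerivAt P (-g x) x := fun x =>
    (hgc.integral_hasStrictDerivAt 0 x).hasDerivAt.neg
  have hPf : ∀ x ∈ Set.Ioo (0 : ℝ) 1, HasDerivAt P (-f x) x := fun x hx => by
    rw [← hgf x (Set.Ioo_subset_Icc_self hx)]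
    exact hPd x
  obtain ⟨c, hc⟩ := exists_eq_add_const_of_hasDerivAt_Ioo hau hPf
  obtain ⟨d, hd⟩ := exists_eq_add_const_of_hasDerivAt_Ioo hav hPf
  set ω : ℝ := 2 * π * (2 + ε) / ε with hω
  have hωε : 1 / ε ≤ ω := by
    rw [hω]
    gcongr
    nlinarith [pi_gt_three]
  have hω1 : 1 ≤ ω := (one_le_one_div hε0 hε1.le).trans hωε
  have hb : ∀ x : ℝ, 1 + α * cos (2 * π * x) - α * cos (ω * x) ≠ 0 := fun x => by
    nlinarith [neg_one_le_cos (2 * π * x), cos_le_one (ω * x)]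
  have hb₀ : ∀ x : ℝ, 1 + α * cos (2 * π * x) ≠ 0 := fun x => by
    nlinarith [neg_one_le_cos (2 * π * x)]
  have hmain : ∀ x ∈ Set.Icc (0 : ℝ) 1, |u x - v x| ≤ 5 * ε * M := fun x hx => by
    refine (abs_sub_le_of_oscillating_coefficient hα hω1 hPd
      (fun x hx => by rw [abs_neg, hgf x hx]; exact hfM x hx)
      hu hu0 hu1 hv hv0 hv1 (c := c) (d := d) (fun x hx => ?_) (fun x hx => ?_) hx).trans ?_
    · have h := hc x hx
      rw [two_scale_coefficient_eq hε0.ne'] at h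
      rw [← h, mul_inv_cancel_left₀ (hb x)]
      exact hud x hx
    · rw [← hd x hx, mul_inv_cancel_left₀ (hb₀ x)]
      exact hvd x hx
    · rw [div_le_iff₀ (by linarith)]
      have : 1 ≤ ω * ε := (div_le_iff₀ hε0).1 hωε
      nlinarith
  have hK : 0 ≤ 5 * ε * M := by positivity
  refine Real.sqrt_le_iff.2 ⟨hK, ?_⟩
  have hint : IntegrableOn (fun x => (u x - v x) ^ 2) (Set.Icc (0 : ℝ) 1) :=
    ((hu.sub hv).pow 2).integrableOn_Icc
  calc ∫ x in Set.Icc (0 : ℝ) 1, (u x - v x) ^ 2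
      ≤ ∫ _ in Set.Icc (0 : ℝ) 1, (5 * ε * M) ^ 2 :=
        setIntegral_mono_on hint continuousOn_const.integrableOn_Icc measurableSet_Icc
          fun x hx => sq_le_sq' (abs_le.1 (hmain x hx)).1 (abs_le.1 (hmain x hx)).2
    _ = (5 * ε * M) ^ 2 := by simp
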